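/- Let H be an n×n complex matrix and fix p ∈ (0,1]. Then the map (A, B) ↦ ( Tr(H B^p H* A^{1−p}) − Tr(HH*A) ) / p is jointly concave in pairs (A, B) of positive definite n×n complex matrices. -/

import Mathlib

open Matrix ComplexOrder

/-- Matrix power `A^p` for real `p` via the continuous functional calculus. -/
noncomputable def mpow {N : Type*} [Fintype N] [DecidableEq N]
    (A : Matrix N N ℂ) (p : ℝ) : Matrix N N ℂ :=
  cfc (fun x : ℝ => x ^ p) A

section LiebHelpers

open MeasureTheory

/-- A spectral decomposition of `A` which also computes all `mpow A q`. -/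
def SpecDec {n : ℕ} (A U : Matrix (Fin n) (Fin n) ℂ) (a : Fin n → ℝ) : Prop :=
  Uᴴ * U = 1 ∧ U * Uᴴ = 1 ∧ (∀ i, 0 < a i) ∧
    A = U * diagonal (fun i => (a i : ℂ)) * Uᴴ ∧
    ∀ q : ℝ, mpow A q = U * diagonal (fun i => ((a i ^ q : ℝ) : ℂ)) * Uᴴ

lemma exists_specDec {n : ℕ} {A : Matrix (Fin n) (Fin n) ℂ} (hA : A.PosDef) :
    ∃ U a, SpecDec A U a := by
  refine ⟨hA.1.eigenvectorUnitary, hA.1.eigenvalues, ?_, ?_, hA.eigenvalues_pos, ?_, ?_⟩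
  · exact Unitary.coe_star_mul_self hA.1.eigenvectorUnitary
  · exact Unitary.coe_mul_star_self hA.1.eigenvectorUnitary
  · have h := hA.1.spectral_theorem
    rw [Unitary.conjStarAlgAut_apply] at h
    exact h
  · intro q
    unfold mpow
    rw [hA.1.cfc_eq, IsHermitian.cfc, Unitary.conjStarAlgAut_apply]
    rfl

lemma trace_diag {n : ℕ} (M : Matrix (Fin n) (Fin n) ℂ) (f g : Fin n → ℝ) :
    (M * diagonal (fun j => (f j : ℂ)) * Mᴴ * diagonal (fun i => (g i : ℂ))).trace
      = ((∑ i, ∑ j, g i * f j * Complex.normSq (M i j) : ℝ) : ℂ) := by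
  simp only [trace, diag_apply, mul_diagonal]
  push_cast
  refine Finset.sum_congr rfl fun i _ => ?_
  rw [mul_apply, Finset.sum_mul]
  refine Finset.sum_congr rfl fun j _ => ?_
  rw [mul_diagonal, conjTranspose_apply, ← Complex.mul_conj]
  simp only [RCLike.star_def]
  ring

lemma trace_spec {n : ℕ} (K U V : Matrix (Fin n) (Fin n) ℂ) (f g : Fin n → ℝ) :
    (K * (V * diagonal (fun j => (f j : ℂ)) * Vᴴ) * Kᴴ
        * (U * diagonal (fun i => (g i : ℂ)) * Uᴴ)).trace
      = ((∑ i, ∑ j, g i * f j * Complex.normSq ((Uᴴ * K * V) i j) : ℝ) : ℂ) := by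
  rw [← trace_diag, ← Matrix.mul_assoc, trace_mul_comm]
  simp only [conjTranspose_mul, conjTranspose_conjTranspose, Matrix.mul_assoc]

/-- The functional which is linear in `(A, B)`. -/
noncomputable def linFun {n : ℕ} (H K : Matrix (Fin n) (Fin n) ℂ) (s : ℝ)
    (A B : Matrix (Fin n) (Fin n) ℂ) : ℝ :=
  (K * Kᴴ * A).trace.re + s⁻¹ * ((H - K) * B * (H - K)ᴴ).trace.re

lemma linFun_mix {n : ℕ} (H K : Matrix (Fin n) (Fin n) ℂ) (s t : ℝ)
    (A₁ A₂ B₁ B₂ : Matrix (Fin n) (Fin n) ℂ) :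
    linFun H K s (t • A₁ + (1 - t) • A₂) (t • B₁ + (1 - t) • B₂)
      = t * linFun H K s A₁ B₁ + (1 - t) * linFun H K s A₂ B₂ := by
  simp only [linFun, Matrix.mul_add, Matrix.add_mul, Matrix.mul_smul, Matrix.smul_mul, trace_add,
    trace_smul, Complex.add_re, Complex.real_smul, Complex.re_ofReal_mul]
  ring

lemma linFun_spec {n : ℕ} (H K : Matrix (Fin n) (Fin n) ℂ) (s : ℝ)
    {A B U V : Matrix (Fin n) (Fin n) ℂ} {a b : Fin n → ℝ}
    (hA : SpecDec A U a) (hB : SpecDec B V b) :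
    linFun H K s A B = ∑ i, ∑ j, (a i * Complex.normSq ((Uᴴ * K * V) i j)
      + s⁻¹ * (b j * Complex.normSq ((Uᴴ * H * V) i j - (Uᴴ * K * V) i j))) := by
  have h1 := trace_spec K U V (fun _ => 1) a
  have h2 := trace_spec (H - K) U V b (fun _ => 1)
  have e : (diagonal fun _ : Fin n => (((1 : ℝ) : ℂ))) = 1 := by simp
  rw [e, Matrix.mul_one, hB.2.1, Matrix.mul_one, ← hA.2.2.2.1] at h1
  rw [e, Matrix.mul_one, hA.2.1, Matrix.mul_one, ← hB.2.2.2.1] at h2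
  rw [linFun, h1, h2, Complex.ofReal_re, Complex.ofReal_re]
  simp only [Finset.mul_sum, ← Finset.sum_add_distrib, Matrix.mul_sub, Matrix.sub_mul,
    Matrix.sub_apply, mul_one, one_mul]

lemma scalar_le {a b s : ℝ} (ha : 0 < a) (hb : 0 < b) (hs : 0 < s) (h k : ℂ) :
    a * b / (s * a + b) * Complex.normSq h
      ≤ a * Complex.normSq k + s⁻¹ * (b * Complex.normSq (h - k)) := by
  have hd : 0 < s * a + b := by positivity
  have key : a * Complex.normSq k + s⁻¹ * (b * Complex.normSq (h - k))
      - a * b / (s * a + b) * Complex.normSq h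
      = Complex.normSq (((s * a + b : ℝ) : ℂ) * k - (b : ℂ) * h) / (s * (s * a + b)) := by
    simp only [Complex.normSq_apply, Complex.sub_re, Complex.sub_im, Complex.re_ofReal_mul,
      Complex.im_ofReal_mul]
    field_simp
    ring
  have : 0 ≤ Complex.normSq (((s * a + b : ℝ) : ℂ) * k - (b : ℂ) * h) / (s * (s * a + b)) :=
    div_nonneg (Complex.normSq_nonneg _) (by positivity)
  linarith

lemma scalar_eq {a b s : ℝ} (ha : 0 < a) (hb : 0 < b) (hs : 0 < s) (h : ℂ) :
    a * Complex.normSq (((b / (s * a + b) : ℝ) : ℂ) * h)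
        + s⁻¹ * (b * Complex.normSq (h - ((b / (s * a + b) : ℝ) : ℂ) * h))
      = a * b / (s * a + b) * Complex.normSq h := by
  have hd : 0 < s * a + b := by positivity
  simp only [Complex.normSq_apply, Complex.sub_re, Complex.sub_im, Complex.re_ofReal_mul,
      Complex.im_ofReal_mul]
  field_simp
  ring

/-- The parallel sum quadratic form in spectral coordinates. -/
noncomputable def parFun {n : ℕ} (H U V : Matrix (Fin n) (Fin n) ℂ) (a b : Fin n → ℝ) (s : ℝ) : ℝ :=
  ∑ i, ∑ j, a i * b j / (s * a i + b j) * Complex.normSq ((Uᴴ * H * V) i j)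

lemma parFun_le {n : ℕ} (H K : Matrix (Fin n) (Fin n) ℂ) {s : ℝ} (hs : 0 < s)
    {A B U V : Matrix (Fin n) (Fin n) ℂ} {a b : Fin n → ℝ}
    (hA : SpecDec A U a) (hB : SpecDec B V b) :
    parFun H U V a b s ≤ linFun H K s A B := by
  rw [linFun_spec H K s hA hB]
  exact Finset.sum_le_sum fun i _ => Finset.sum_le_sum fun j _ =>
    scalar_le (hA.2.2.1 i) (hB.2.2.1 j) hs _ _

lemma exists_parFun_eq {n : ℕ} (H : Matrix (Fin n) (Fin n) ℂ) {s : ℝ} (hs : 0 < s)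
    {A B U V : Matrix (Fin n) (Fin n) ℂ} {a b : Fin n → ℝ}
    (hA : SpecDec A U a) (hB : SpecDec B V b) :
    ∃ K, linFun H K s A B = parFun H U V a b s := by
  refine ⟨U * (Matrix.of fun i j =>
    ((b j / (s * a i + b j) : ℝ) : ℂ) * (Uᴴ * H * V) i j) * Vᴴ, ?_⟩
  rw [linFun_spec H _ s hA hB]
  have e : ∀ X : Matrix (Fin n) (Fin n) ℂ, Uᴴ * (U * X * Vᴴ) * V = X := by
    intro X
    calc Uᴴ * (U * X * Vᴴ) * V = (Uᴴ * U) * X * (Vᴴ * V) := by simp only [Matrix.mul_assoc]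
      _ = X := by rw [hA.1, hB.1, Matrix.one_mul, Matrix.mul_one]
  rw [e]
  exact Finset.sum_congr rfl fun i _ => Finset.sum_congr rfl fun j _ =>
    scalar_eq (hA.2.2.1 i) (hB.2.2.1 j) hs _

lemma parFun_concave {n : ℕ} (H : Matrix (Fin n) (Fin n) ℂ) {s t : ℝ} (hs : 0 < s)
    (ht0 : 0 ≤ t) (ht1 : t ≤ 1)
    {A₁ A₂ B₁ B₂ U₁ U₂ V₁ V₂ U V : Matrix (Fin n) (Fin n) ℂ} {a₁ a₂ b₁ b₂ a b : Fin n → ℝ}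
    (hA₁ : SpecDec A₁ U₁ a₁) (hB₁ : SpecDec B₁ V₁ b₁)
    (hA₂ : SpecDec A₂ U₂ a₂) (hB₂ : SpecDec B₂ V₂ b₂)
    (hA : SpecDec (t • A₁ + (1 - t) • A₂) U a) (hB : SpecDec (t • B₁ + (1 - t) • B₂) V b) :
    t * parFun H U₁ V₁ a₁ b₁ s + (1 - t) * parFun H U₂ V₂ a₂ b₂ s ≤ parFun H U V a b s := by
  obtain ⟨K, hK⟩ := exists_parFun_eq H hs hA hB
  rw [← hK, linFun_mix]
  exact add_le_add (mul_le_mul_of_nonneg_left (parFun_le H K hs hA₁ hB₁) ht0)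
    (mul_le_mul_of_nonneg_left (parFun_le H K hs hA₂ hB₂) (by linarith))

lemma scalar_int {p : ℝ} (hp : p ∈ Set.Ioo (0 : ℝ) 1) {μ : Measure ℝ}
    (hμ : ∀ x ∈ Set.Ici (0 : ℝ),
      IntegrableOn (fun t => Real.rpowIntegrand₀₁ p t x) (Set.Ioi 0) μ
      ∧ x ^ p = ∫ t in Set.Ioi 0, Real.rpowIntegrand₀₁ p t x ∂μ)
    {a b : ℝ} (ha : 0 < a) (hb : 0 < b) :
    IntegrableOn (fun s => s ^ (p - 1) * (a * b / (s * a + b))) (Set.Ioi 0) μ ∧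
    a ^ (1 - p) * b ^ p = ∫ s in Set.Ioi 0, s ^ (p - 1) * (a * b / (s * a + b)) ∂μ := by
  obtain ⟨h1, h2⟩ := hμ (b / a) (by simp only [Set.mem_Ici]; positivity)
  have e : Set.EqOn (fun s => a * Real.rpowIntegrand₀₁ p s (b / a))
      (fun s => s ^ (p - 1) * (a * b / (s * a + b))) (Set.Ioi 0) := by
    intro s hs
    have hs : 0 < s := hs
    have hd : 0 < s * a + b := by positivity
    simp only [Real.rpowIntegrand₀₁]
    rw [Real.rpow_sub hs, Real.rpow_one]
    have : s + b / a = (s * a + b) / a := by field_simp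
    rw [this]
    field_simp
    ring
  refine ⟨IntegrableOn.congr_fun (h1.const_mul a) e measurableSet_Ioi, ?_⟩
  rw [← setIntegral_congr_fun measurableSet_Ioi e, integral_const_mul, ← h2,
    Real.div_rpow hb.le ha.le, Real.rpow_sub ha, Real.rpow_one]
  have : 0 < a ^ p := Real.rpow_pos_of_pos ha p
  field_simp

lemma sum_int {n : ℕ} {p : ℝ} (hp : p ∈ Set.Ioo (0 : ℝ) 1) {μ : Measure ℝ}
    (hμ : ∀ x ∈ Set.Ici (0 : ℝ),
      IntegrableOn (fun t => Real.rpowIntegrand₀₁ p t x) (Set.Ioi 0) μ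
      ∧ x ^ p = ∫ t in Set.Ioi 0, Real.rpowIntegrand₀₁ p t x ∂μ)
    (H : Matrix (Fin n) (Fin n) ℂ)
    {A B U V : Matrix (Fin n) (Fin n) ℂ} {a b : Fin n → ℝ}
    (hA : SpecDec A U a) (hB : SpecDec B V b) :
    IntegrableOn (fun s => s ^ (p - 1) * parFun H U V a b s) (Set.Ioi 0) μ ∧
    (H * mpow B p * Hᴴ * mpow A (1 - p)).trace
      = ((∫ s in Set.Ioi 0, s ^ (p - 1) * parFun H U V a b s ∂μ : ℝ) : ℂ) := by
  have e : (fun s => s ^ (p - 1) * parFun H U V a b s) = fun s => ∑ i, ∑ j,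
      (s ^ (p - 1) * (a i * b j / (s * a i + b j))) * Complex.normSq ((Uᴴ * H * V) i j) := by
    funext s
    simp only [parFun, Finset.mul_sum, mul_assoc]
  have hI : ∀ i j, Integrable (fun s => (s ^ (p - 1) * (a i * b j / (s * a i + b j)))
      * Complex.normSq ((Uᴴ * H * V) i j)) (μ.restrict (Set.Ioi 0)) := fun i j =>
    Integrable.mul_const (scalar_int hp hμ (hA.2.2.1 i) (hB.2.2.1 j)).1 _
  rw [e]
  refine ⟨integrable_finsetSum _ fun i _ => integrable_finsetSum _ fun j _ => hI i j, ?_⟩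
  rw [integral_finsetSum _ fun i _ => integrable_finsetSum _ fun j _ => hI i j,
    hA.2.2.2.2, hB.2.2.2.2, trace_spec]
  congr 1
  refine Finset.sum_congr rfl fun i _ => ?_
  rw [integral_finsetSum _ fun j _ => hI i j]
  refine Finset.sum_congr rfl fun j _ => ?_
  rw [integral_mul_const, ← (scalar_int hp hμ (hA.2.2.1 i) (hB.2.2.1 j)).2]

lemma posDef_mix {n : ℕ} {A₁ A₂ : Matrix (Fin n) (Fin n) ℂ} (h₁ : A₁.PosDef) (h₂ : A₂.PosDef)
    {t : ℝ} (ht0 : 0 ≤ t) (ht1 : t ≤ 1) : (t • A₁ + (1 - t) • A₂).PosDef := by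
  rcases ht0.eq_or_lt with h | h
  · subst h; simpa using h₂
  · exact (h₁.smul h).add_posSemidef (h₂.posSemidef.smul (by linarith))

lemma lieb_concave {n : ℕ} (H : Matrix (Fin n) (Fin n) ℂ)
    (p : ℝ) (hp : p ∈ Set.Ioc (0 : ℝ) 1)
    (A₁ A₂ B₁ B₂ : Matrix (Fin n) (Fin n) ℂ)
    (hA₁ : A₁.PosDef) (hA₂ : A₂.PosDef) (hB₁ : B₁.PosDef) (hB₂ : B₂.PosDef)
    (t : ℝ) (ht0 : 0 ≤ t) (ht1 : t ≤ 1) :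
    (t : ℂ) * (H * mpow B₁ p * Hᴴ * mpow A₁ (1 - p)).trace
      + (1 - (t : ℂ)) * (H * mpow B₂ p * Hᴴ * mpow A₂ (1 - p)).trace
    ≤ (H * mpow (t • B₁ + (1 - t) • B₂) p * Hᴴ
          * mpow (t • A₁ + (1 - t) • A₂) (1 - p)).trace := by
  obtain ⟨U₁, a₁, sA₁⟩ := exists_specDec hA₁
  obtain ⟨U₂, a₂, sA₂⟩ := exists_specDec hA₂
  obtain ⟨V₁, b₁, sB₁⟩ := exists_specDec hB₁
  obtain ⟨V₂, b₂, sB₂⟩ := exists_specDec hB₂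
  obtain ⟨U, a, sA⟩ := exists_specDec (posDef_mix hA₁ hA₂ ht0 ht1)
  obtain ⟨V, b, sB⟩ := exists_specDec (posDef_mix hB₁ hB₂ ht0 ht1)
  rcases hp.2.eq_or_lt with h1 | h1
  · subst h1
    have h0 : ∀ {A U : Matrix (Fin n) (Fin n) ℂ} {a : Fin n → ℝ}, SpecDec A U a →
        mpow A (1 - 1) = 1 := by
      intro A U a h
      rw [h.2.2.2.2]
      simp [h.2.1]
    have h1 : ∀ {A U : Matrix (Fin n) (Fin n) ℂ} {a : Fin n → ℝ}, SpecDec A U a →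
        mpow A 1 = A := by
      intro A U a h
      rw [h.2.2.2.2]
      conv_rhs => rw [h.2.2.2.1]
      simp
    rw [h0 sA₁, h0 sA₂, h0 sA, h1 sB₁, h1 sB₂, h1 sB]
    apply le_of_eq
    simp only [Matrix.mul_add, Matrix.add_mul, Matrix.mul_smul, Matrix.smul_mul, trace_add,
      trace_smul, Complex.real_smul, Matrix.mul_one]
    push_cast
    ring
  · obtain ⟨μ, hμ⟩ := Real.exists_measure_rpow_eq_integral_rpowIntegrand₀₁ ⟨hp.1, h1⟩
    obtain ⟨i1, e1⟩ := sum_int ⟨hp.1, h1⟩ hμ H sA₁ sB₁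
    obtain ⟨i2, e2⟩ := sum_int ⟨hp.1, h1⟩ hμ H sA₂ sB₂
    obtain ⟨i3, e3⟩ := sum_int ⟨hp.1, h1⟩ hμ H sA sB
    rw [e1, e2, e3]
    have key : t * (∫ s in Set.Ioi 0, s ^ (p - 1) * parFun H U₁ V₁ a₁ b₁ s ∂μ)
        + (1 - t) * (∫ s in Set.Ioi 0, s ^ (p - 1) * parFun H U₂ V₂ a₂ b₂ s ∂μ)
        ≤ ∫ s in Set.Ioi 0, s ^ (p - 1) * parFun H U V a b s ∂μ := by
      rw [← integral_const_mul, ← integral_const_mul,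
        ← integral_add (i1.const_mul t) (i2.const_mul (1 - t))]
      refine setIntegral_mono_on ((i1.const_mul t).add (i2.const_mul (1 - t))) i3
        measurableSet_Ioi fun s hs => ?_
      have hs : 0 < s := hs
      have h := mul_le_mul_of_nonneg_left
        (parFun_concave H hs ht0 ht1 sA₁ sB₁ sA₂ sB₂ sA sB) (Real.rpow_nonneg hs.le (p - 1))
      linarith
    exact_mod_cast key

end LiebHelpers

/-- For fixed `p ∈ (0,1]`, the map
`(A, B) ↦ (Tr(H B^p H* A^{1−p}) − Tr(HH*A)) / p` is jointly concave in pairs of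
positive definite matrices. -/
theorem trace_power_difference_concave {n : ℕ} (H : Matrix (Fin n) (Fin n) ℂ)
    (p : ℝ) (hp : p ∈ Set.Ioc (0 : ℝ) 1)
    (A₁ A₂ B₁ B₂ : Matrix (Fin n) (Fin n) ℂ)
    (hA₁ : A₁.PosDef) (hA₂ : A₂.PosDef) (hB₁ : B₁.PosDef) (hB₂ : B₂.PosDef)
    (t : ℝ) (ht0 : 0 ≤ t) (ht1 : t ≤ 1) :
    ((H * mpow (t • B₁ + (1 - t) • B₂) p * Hᴴ
          * mpow (t • A₁ + (1 - t) • A₂) (1 - p)).trace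
        - (H * Hᴴ * (t • A₁ + (1 - t) • A₂)).trace) / (p : ℂ) ≥
      (t : ℂ) * (((H * mpow B₁ p * Hᴴ * mpow A₁ (1 - p)).trace
          - (H * Hᴴ * A₁).trace) / (p : ℂ)) +
        (1 - (t : ℂ)) * (((H * mpow B₂ p * Hᴴ * mpow A₂ (1 - p)).trace
          - (H * Hᴴ * A₂).trace) / (p : ℂ)) := by
  have h := lieb_concave H p hp A₁ A₂ B₁ B₂ hA₁ hA₂ hB₁ hB₂ t ht0 ht1
  have hp' : (0 : ℂ) ≤ ((p⁻¹ : ℝ) : ℂ) := by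
    exact_mod_cast inv_nonneg.mpr hp.1.le
  have h2 := mul_le_mul_of_nonneg_right (sub_le_sub_right h
    (H * Hᴴ * (t • A₁ + (1 - t) • A₂)).trace) hp'
  have e : (H * Hᴴ * (t • A₁ + (1 - t) • A₂)).trace
      = (t : ℂ) * (H * Hᴴ * A₁).trace + (1 - (t : ℂ)) * (H * Hᴴ * A₂).trace := by
    simp only [Matrix.mul_add, Matrix.mul_smul, trace_add, trace_smul, Complex.real_smul]
    push_cast
    ring
  simp only [ge_iff_le, div_eq_mul_inv, ← Complex.ofReal_inv]
  refine le_trans (le_of_eq ?_) h2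
  rw [e]
  push_cast
  ring
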